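/- arXiv:1507.05980 — 2 statements merged into one kernel-verified Lean document; each statement's English description precedes it below -/
import Mathlib

section
/- Let G be a finite simple graph with a nonnegative edge-weight function w and terminals s₁,t₁,…,s_k,t_k, and let (Q₁,…,Q_k) be a feasible family of paths (Q_i a path from s_i to t_i, pairwise vertex-disjoint) of minimum total weight among all feasible families. Fix an index i and vertices u, v on Q_i with u preceding v along Q_i, and let α′ be a path from u to v in G such that (a) no vertex of α′ other than u and v lies on Q_i[s_i,u] or on Q_i[v,t_i], and (b) α′ shares no vertex with Q_h for every h ≠ i. Then the weight of α′ is at least the weight of Q_i[u,v]. -/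
/-- In a minimum-weight disjoint family of walks, a walk avoiding all the others
is at least as heavy as the member of the family with the same ends. -/
theorem weight_le_of_disjoint_from_others {V ι : Type*} [Fintype ι] {G : SimpleGraph V}
    (w : Sym2 V → ℝ) {s t : ι → V} (Q : ∀ i, G.Walk (s i) (t i))
    (hdisj : ∀ i j, i ≠ j → ∀ x, x ∈ (Q i).support → x ∉ (Q j).support)
    (hmin : ∀ W' : ∀ i, G.Walk (s i) (t i),
      (∀ i j, i ≠ j → ∀ x, x ∈ (W' i).support → x ∉ (W' j).support) →
      ∑ i, ((Q i).edges.map w).sum ≤ ∑ i, ((W' i).edges.map w).sum)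
    (i : ι) (R : G.Walk (s i) (t i))
    (hR : ∀ h, h ≠ i → ∀ x ∈ R.support, x ∉ (Q h).support) :
    ((Q i).edges.map w).sum ≤ (R.edges.map w).sum := by
  classical
  have key := hmin (Function.update Q i R) fun a b hab x hxa hxb => by
    rcases eq_or_ne a i with rfl | hai
    · rw [Function.update_self] at hxa
      rw [Function.update_of_ne hab.symm] at hxb
      exact hR b hab.symm x hxa hxb
    · rw [Function.update_of_ne hai] at hxa
      rcases eq_or_ne b i with rfl | hbi
      · rw [Function.update_self] at hxb
        exact hR a hai x hxb hxa
      · rw [Function.update_of_ne hbi] at hxb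
        exact hdisj a b hab x hxa hxb
  rw [← Finset.add_sum_erase _ _ (Finset.mem_univ i),
    ← Finset.add_sum_erase _ _ (Finset.mem_univ i), Function.update_self,
    Finset.sum_congr rfl fun j hj => by
      rw [← Function.update_of_ne (Finset.ne_of_mem_erase hj) R Q]] at key
  exact le_of_add_le_add_right key


/-- Let `G` be a finite simple graph with a nonnegative edge-weight
function `w` and terminals `s₁, t₁, …, s_k, t_k`, and let `(Q₁, …, Q_k)` be a feasible
family of paths (`Q i` a path from `s i` to `t i`, pairwise vertex-disjoint) of
minimum total weight among all feasible families.  Fix an index `i` and vertices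
`u, v` on `Q i` with `u` preceding `v` along `Q i`, and let `α'` be a path from `u`
to `v` in `G` such that (a) no vertex of `α'` other than `u` and `v` lies on
`Q i[s i, u]` or on `Q i[v, t i]`, and (b) `α'` shares no vertex with `Q h` for every
`h ≠ i`.  Then the weight of `α'` is at least the weight of `Q i[u, v]`. -/
theorem single_subpath_exchange
    {V : Type*} [Fintype V] [DecidableEq V] {G : SimpleGraph V}
    (w : Sym2 V → ℝ) (hw : ∀ e ∈ G.edgeSet, 0 ≤ w e)
    (k : ℕ) (s t : Fin k → V)
    (Q : ∀ i, G.Walk (s i) (t i)) (hpath : ∀ i, (Q i).IsPath)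
    (hdisj : ∀ i j, i ≠ j → ∀ x, x ∈ (Q i).support → x ∉ (Q j).support)
    (hmin : ∀ W' : ∀ i, G.Walk (s i) (t i),
      (∀ i j, i ≠ j → ∀ x, x ∈ (W' i).support → x ∉ (W' j).support) →
      ∑ i, ((Q i).edges.map w).sum ≤ ∑ i, ((W' i).edges.map w).sum)
    (i : Fin k) {u v : V}
    (hu : u ∈ (Q i).support) (hv : v ∈ ((Q i).dropUntil u hu).support)
    (α' : G.Walk u v) (hα' : α'.IsPath)
    (ha : ∀ x ∈ α'.support, x ≠ u → x ≠ v →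
      x ∉ ((Q i).takeUntil u hu).support ∧
      x ∉ (((Q i).dropUntil u hu).dropUntil v hv).support)
    (hb : ∀ h, h ≠ i → ∀ x ∈ α'.support, x ∉ (Q h).support) :
    ((((Q i).dropUntil u hu).takeUntil v hv).edges.map w).sum
      ≤ (α'.edges.map w).sum := by
  have hsplit : ((Q i).takeUntil u hu).append
      ((((Q i).dropUntil u hu).takeUntil v hv).append
        (((Q i).dropUntil u hu).dropUntil v hv)) = Q i := by
    rw [SimpleGraph.Walk.take_spec, SimpleGraph.Walk.take_spec]
  have key := weight_le_of_disjoint_from_others w Q hdisj hmin i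
    (((Q i).takeUntil u hu).append (α'.append (((Q i).dropUntil u hu).dropUntil v hv)))
    fun h hne x hx => by
      simp only [SimpleGraph.Walk.mem_support_append_iff] at hx
      rcases hx with hx | hx | hx
      · exact hdisj i h hne.symm x ((Q i).support_takeUntil_subset_support hu hx)
      · exact hb h hne x hx
      · exact hdisj i h hne.symm x ((Q i).support_dropUntil_subset_support hu
          (((Q i).dropUntil u hu).support_dropUntil_subset_support hv hx))
  have hweight := congrArg (fun p => (p.edges.map w).sum) hsplit
  simp only [SimpleGraph.Walk.edges_append, List.map_append, List.sum_append] at key hweight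
  linarith
end

section
/- Let G be a finite simple graph with a nonnegative edge-weight function w and terminals s₁,t₁,…,s_k,t_k, and let (Q₁,…,Q_k) be a feasible family of paths (Q_i a path from s_i to t_i, pairwise vertex-disjoint) of minimum total weight among all feasible families. Fix distinct indices i ≠ j, vertices x_i, y_i on Q_i with x_i preceding y_i, and vertices x_j, y_j on Q_j with x_j preceding y_j. Let β′ be a path from x_i to y_i and γ′ a path from x_j to y_j such that: (a) no vertex of β′ other than x_i and y_i lies on Q_i[s_i,x_i] or on Q_i[y_i,t_i]; (b) no vertex of γ′ other than x_j and y_j lies on Q_j[s_j,x_j] or on Q_j[y_j,t_j]; (c) β′ shares no vertex with Q_h for every h ∉ {i,j} and no vertex with Q_j[s_j,x_j] or Q_j[y_j,t_j]; (d) γ′ shares no vertex with Q_h for every h ∉ {i,j} and no vertex with Q_i[s_i,x_i] or Q_i[y_i,t_i]; and (e) β′ and γ′ share no vertex. Then w(β′) + w(γ′) ≥ w(Q_i[x_i,y_i]) + w(Q_j[x_j,y_j]). -/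
namespace SimpleGraph.Walk

variable {V : Type*} [DecidableEq V] {G : SimpleGraph V}

/-- The walk obtained from `p` by replacing its portion from `x` to `y` by the walk `r`. -/
def replaceBetween {u v x y : V} (p : G.Walk u v) (hx : x ∈ p.support)
    (hy : y ∈ (p.dropUntil x hx).support) (r : G.Walk x y) : G.Walk u v :=
  (p.takeUntil x hx).append (r.append ((p.dropUntil x hx).dropUntil y hy))

theorem mem_support_replaceBetween_iff {u v x y z : V} (p : G.Walk u v) (hx : x ∈ p.support)
    (hy : y ∈ (p.dropUntil x hx).support) (r : G.Walk x y) :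
    z ∈ (p.replaceBetween hx hy r).support ↔
      z ∈ (p.takeUntil x hx).support ∨ z ∈ r.support ∨
        z ∈ ((p.dropUntil x hx).dropUntil y hy).support := by
  simp only [replaceBetween, mem_support_append_iff]

theorem mem_support_of_mem_support_replaceBetween {u v x y z : V} (p : G.Walk u v)
    (hx : x ∈ p.support) (hy : y ∈ (p.dropUntil x hx).support) (r : G.Walk x y)
    (hz : z ∈ (p.replaceBetween hx hy r).support) : z ∈ p.support ∨ z ∈ r.support := by
  rcases (p.mem_support_replaceBetween_iff hx hy r).1 hz with h | h | h
  · exact .inl (p.support_takeUntil_subset_support hx h)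
  · exact .inr h
  · exact .inl (p.support_dropUntil_subset_support hx (support_dropUntil_subset_support _ hy h))

theorem sum_map_edges_replaceBetween {u v x y : V} {M : Type*} [AddCommGroup M] (w : Sym2 V → M)
    (p : G.Walk u v) (hx : x ∈ p.support) (hy : y ∈ (p.dropUntil x hx).support)
    (r : G.Walk x y) :
    ((p.replaceBetween hx hy r).edges.map w).sum - (p.edges.map w).sum =
      (r.edges.map w).sum - (((p.dropUntil x hx).takeUntil y hy).edges.map w).sum := by
  have hp : (p.takeUntil x hx).append (((p.dropUntil x hx).takeUntil y hy).append
      ((p.dropUntil x hx).dropUntil y hy)) = p := by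
    rw [take_spec, take_spec]
  conv_lhs => rw [← congrArg edges hp]
  simp only [replaceBetween, edges_append, List.map_append, List.sum_append]
  abel

end SimpleGraph.Walk

/-- If a family of walks is pairwise vertex-disjoint, it stays so after replacing two members by
walks that are disjoint from each other and from all the remaining members. -/
theorem SimpleGraph.Walk.pairwise_disjoint_update_update {V ι : Type*} [DecidableEq ι]
    {G : SimpleGraph V} {s t : ι → V} (Q : ∀ i, G.Walk (s i) (t i))
    (hQ : ∀ i j, i ≠ j → ∀ x, x ∈ (Q i).support → x ∉ (Q j).support)
    {i j : ι} (p : G.Walk (s i) (t i)) (q : G.Walk (s j) (t j))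
    (hp : ∀ h, h ≠ i → h ≠ j → ∀ x ∈ p.support, x ∉ (Q h).support)
    (hq : ∀ h, h ≠ i → h ≠ j → ∀ x ∈ q.support, x ∉ (Q h).support)
    (hpq : ∀ x ∈ p.support, x ∉ q.support) (a b : ι) (hab : a ≠ b) (x : V)
    (hxa : x ∈ (Function.update (Function.update Q i p) j q a).support) :
    x ∉ (Function.update (Function.update Q i p) j q b).support := by
  intro hxb
  by_cases haj : a = j
  · subst haj
    rw [Function.update_self] at hxa
    rw [Function.update_of_ne hab.symm] at hxb
    by_cases hbi : b = i
    · subst hbi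
      rw [Function.update_self] at hxb
      exact hpq x hxb hxa
    · rw [Function.update_of_ne hbi] at hxb
      exact hq b hbi hab.symm x hxa hxb
  rw [Function.update_of_ne haj] at hxa
  by_cases hbj : b = j
  · subst hbj
    rw [Function.update_self] at hxb
    by_cases hai : a = i
    · subst hai
      rw [Function.update_self] at hxa
      exact hpq x hxa hxb
    · rw [Function.update_of_ne hai] at hxa
      exact hq a hai haj x hxb hxa
  rw [Function.update_of_ne hbj] at hxb
  by_cases hai : a = i
  · subst hai
    rw [Function.update_self] at hxa
    rw [Function.update_of_ne hab.symm] at hxb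
    exact hp b hab.symm hbj x hxa hxb
  rw [Function.update_of_ne hai] at hxa
  by_cases hbi : b = i
  · subst hbi
    rw [Function.update_self] at hxb
    exact hp a hab haj x hxb hxa
  rw [Function.update_of_ne hbi] at hxb
  exact hQ a b hab x hxa hxb


/-- Let `G` be a finite simple graph with a nonnegative edge-weight
function `w` and terminals `s₁, t₁, …, s_k, t_k`, and let `(Q₁, …, Q_k)` be a feasible
family of paths of minimum total weight among all feasible families.  Fix distinct
indices `i ≠ j`, vertices `xi, yi` on `Q i` with `xi` preceding `yi`, and vertices
`xj, yj` on `Q j` with `xj` preceding `yj`.  Let `β'` be a path from `xi` to `yi` and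
`γ'` a path from `xj` to `yj` such that: (a) no vertex of `β'` other than `xi` and
`yi` lies on `Q i[s i, xi]` or on `Q i[yi, t i]`; (b) no vertex of `γ'` other than
`xj` and `yj` lies on `Q j[s j, xj]` or on `Q j[yj, t j]`; (c) `β'` shares no vertex
with `Q h` for every `h ∉ {i, j}` and no vertex with `Q j[s j, xj]` or `Q j[yj, t j]`;
(d) `γ'` shares no vertex with `Q h` for every `h ∉ {i, j}` and no vertex with
`Q i[s i, xi]` or `Q i[yi, t i]`; and (e) `β'` and `γ'` share no vertex.  Then
`w(β') + w(γ') ≥ w(Q i[xi, yi]) + w(Q j[xj, yj])`. -/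
theorem two_subpath_exchange
    {V : Type*} [Fintype V] [DecidableEq V] {G : SimpleGraph V}
    (w : Sym2 V → ℝ) (hw : ∀ e ∈ G.edgeSet, 0 ≤ w e)
    (k : ℕ) (s t : Fin k → V)
    (Q : ∀ i, G.Walk (s i) (t i)) (hpath : ∀ i, (Q i).IsPath)
    (hdisj : ∀ i j, i ≠ j → ∀ x, x ∈ (Q i).support → x ∉ (Q j).support)
    (hmin : ∀ W' : ∀ i, G.Walk (s i) (t i),
      (∀ i j, i ≠ j → ∀ x, x ∈ (W' i).support → x ∉ (W' j).support) →
      ∑ i, ((Q i).edges.map w).sum ≤ ∑ i, ((W' i).edges.map w).sum)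
    (i j : Fin k) (hij : i ≠ j) {xi yi xj yj : V}
    (hxi : xi ∈ (Q i).support) (hyi : yi ∈ ((Q i).dropUntil xi hxi).support)
    (hxj : xj ∈ (Q j).support) (hyj : yj ∈ ((Q j).dropUntil xj hxj).support)
    (β' : G.Walk xi yi) (hβ' : β'.IsPath)
    (γ' : G.Walk xj yj) (hγ' : γ'.IsPath)
    (ha : ∀ x ∈ β'.support, x ≠ xi → x ≠ yi →
      x ∉ ((Q i).takeUntil xi hxi).support ∧
      x ∉ (((Q i).dropUntil xi hxi).dropUntil yi hyi).support)
    (hb : ∀ x ∈ γ'.support, x ≠ xj → x ≠ yj →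
      x ∉ ((Q j).takeUntil xj hxj).support ∧
      x ∉ (((Q j).dropUntil xj hxj).dropUntil yj hyj).support)
    (hc : (∀ h, h ≠ i → h ≠ j → ∀ x ∈ β'.support, x ∉ (Q h).support) ∧
      (∀ x ∈ β'.support,
        x ∉ ((Q j).takeUntil xj hxj).support ∧
        x ∉ (((Q j).dropUntil xj hxj).dropUntil yj hyj).support))
    (hd : (∀ h, h ≠ i → h ≠ j → ∀ x ∈ γ'.support, x ∉ (Q h).support) ∧
      (∀ x ∈ γ'.support,
        x ∉ ((Q i).takeUntil xi hxi).support ∧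
        x ∉ (((Q i).dropUntil xi hxi).dropUntil yi hyi).support))
    (he : ∀ x ∈ β'.support, x ∉ γ'.support) :
    ((((Q i).dropUntil xi hxi).takeUntil yi hyi).edges.map w).sum
      + ((((Q j).dropUntil xj hxj).takeUntil yj hyj).edges.map w).sum
      ≤ (β'.edges.map w).sum + (γ'.edges.map w).sum := by
  set Wi := (Q i).replaceBetween hxi hyi β' with hWi
  set Wj := (Q j).replaceBetween hxj hyj γ' with hWj
  have hi : ∀ h, h ≠ i → h ≠ j → ∀ x ∈ Wi.support, x ∉ (Q h).support := by
    intro h hhi hhj x hx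
    rcases (Q i).mem_support_of_mem_support_replaceBetween hxi hyi β' hx with hx | hx
    · exact hdisj i h hhi.symm x hx
    · exact hc.1 h hhi hhj x hx
  have hj : ∀ h, h ≠ i → h ≠ j → ∀ x ∈ Wj.support, x ∉ (Q h).support := by
    intro h hhi hhj x hx
    rcases (Q j).mem_support_of_mem_support_replaceBetween hxj hyj γ' hx with hx | hx
    · exact hdisj j h hhj.symm x hx
    · exact hd.1 h hhi hhj x hx
  have hWij : ∀ x ∈ Wi.support, x ∉ Wj.support := by
    intro x hx hx'
    rcases (Q j).mem_support_of_mem_support_replaceBetween hxj hyj γ' hx' with hQj | hγ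
    · rcases (Q i).mem_support_of_mem_support_replaceBetween hxi hyi β' hx with hQi | hβ
      · exact hdisj i j hij x hQi hQj
      · rw [hWj, SimpleGraph.Walk.mem_support_replaceBetween_iff] at hx'
        rcases hx' with h | h | h
        · exact (hc.2 x hβ).1 h
        · exact he x hβ h
        · exact (hc.2 x hβ).2 h
    · rw [hWi, SimpleGraph.Walk.mem_support_replaceBetween_iff] at hx
      rcases hx with h | h | h
      · exact (hd.2 x hγ).1 h
      · exact he x h hγ
      · exact (hd.2 x hγ).2 h
  set W := Function.update (Function.update Q i Wi) j Wj with hW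
  have hle := hmin W
    (SimpleGraph.Walk.pairwise_disjoint_update_update Q hdisj Wi Wj hi hj hWij)
  have hsum : ∑ h, (((W h).edges.map w).sum - ((Q h).edges.map w).sum) =
      (((W i).edges.map w).sum - ((Q i).edges.map w).sum) +
        (((W j).edges.map w).sum - ((Q j).edges.map w).sum) := by
    refine Fintype.sum_eq_add i j hij fun h hh => ?_
    rw [hW, Function.update_of_ne hh.2, Function.update_of_ne hh.1, sub_self]
  have hWWi : W i = Wi := by rw [hW, Function.update_of_ne hij, Function.update_self]
  have hWWj : W j = Wj := by rw [hW, Function.update_self]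
  rw [Finset.sum_sub_distrib, hWWi, hWWj, hWi, hWj,
    SimpleGraph.Walk.sum_map_edges_replaceBetween,
    SimpleGraph.Walk.sum_map_edges_replaceBetween] at hsum
  linarith
end
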